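/- arXiv:1409.1487 — 2 statements merged into one kernel-verified Lean document; each statement's English description precedes it below -/
import Mathlib

section
/- In any finite single-player perception game (finite type set T, finite action set A, prior β ∈ Δ(T), utility u : T × A × Δ(T) → ℝ) in which u is continuous in its last argument, there exists a perception equilibrium, i.e., a strategy σ : T → Δ(A) and perception τ : T → A → Δ(T) such that (1) τ is Bayesian-consistent with β and σ on every action in the support of some type's strategy, and (2) for every type t, σ(t) maximizes the expected utility Σ_a σ(t)(a)·u(t,a,τ(t)(a)) over all mixed actions. -/
open Finset

section PerceptionGame
variable {T A : Type*} [Fintype T] [Fintype A]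

/-- Total probability of action `a` under prior `β` and strategy `σ`. -/
def actProb (β : T → ℝ) (σ : T → A → ℝ) (a : A) : ℝ := ∑ t, β t * σ t a

/-- Bayesian consistency of a perception with the prior and strategy. -/
def Consistent (β : T → ℝ) (σ : T → A → ℝ) (τ : T → A → T → ℝ) : Prop :=
  ∀ a, 0 < actProb β σ a → ∀ t tb, τ t a tb = β tb * σ tb a / actProb β σ a

/-- Expected utility of type `t` playing mixed action `s`, given perception `τ`. -/
def ExpUtil (u : T → A → (T → ℝ) → ℝ) (τ : T → A → T → ℝ) (t : T) (s : A → ℝ) : ℝ :=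
  ∑ a, s a * u t a (τ t a)

/-- Perception equilibrium: a consistent strategy–perception pair where
every type's strategy is a best reply. -/
def PerceptionEqm (β : T → ℝ) (u : T → A → (T → ℝ) → ℝ)
    (σ : T → A → ℝ) (τ : T → A → T → ℝ) : Prop :=
  (∀ t, σ t ∈ stdSimplex ℝ A) ∧ (∀ t a, τ t a ∈ stdSimplex ℝ T) ∧
  Consistent β σ τ ∧
  ∀ t, ∀ s ∈ stdSimplex ℝ A, ExpUtil u τ t s ≤ ExpUtil u τ t (σ t)

end PerceptionGame

section Scarf

variable {W I : Type*}

/-- Every point lies weakly below the whole of `S` in one of the rankings `r i`. -/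
def Dominant (r : I → W → ℕ) (S : Finset W) : Prop :=
  ∀ y, ∃ i, ∀ x ∈ S, r i y ≤ r i x

lemma Dominant.mono {r : I → W → ℕ} {S S' : Finset W} (h : Dominant r S) (hS : S' ⊆ S) :
    Dominant r S' := fun y => (h y).imp fun _ hi x hx => hi x (hS hx)

/-- A dominant set with one element less than there are rankings has exactly two one-point
dominant extensions. -/
lemma Dominant.card_extensions [Fintype W] [Fintype I] [DecidableEq W] {r : I → W → ℕ}
    (hr : ∀ i, Function.Injective (r i)) {τ : Finset W} (hτ : Dominant r τ) (hne : τ.Nonempty)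
    (hcard : #τ + 1 = Fintype.card I)
    (hM : ∀ j, ∃ y, ∀ i, i ≠ j → ∃ x ∈ τ, r i x < r i y)
    [DecidablePred fun x => x ∉ τ ∧ Dominant r (insert x τ)] :
    #{x | x ∉ τ ∧ Dominant r (insert x τ)} = 2 := by
  classical
  choose m hmτ hmin using fun i => τ.exists_min_image (r i) hne
  have hdom : ∀ y, ∃ i, r i y ≤ r i (m i) := fun y => (hτ y).imp fun i hi => hi _ (hmτ i)
  have hmem : ∀ {z i}, z ∈ τ → r i z ≤ r i (m i) → m i = z := fun {z i} hz h =>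
    hr i (le_antisymm (hmin i z hz) h)
  obtain ⟨a, b, hab, hmab⟩ : ∃ a b, a ≠ b ∧ m a = m b := by
    obtain ⟨a, b, hab, h⟩ := Fintype.exists_ne_map_eq_of_card_lt
      (fun i => (⟨m i, hmτ i⟩ : τ)) (by rw [Fintype.card_coe]; omega)
    exact ⟨a, b, hab, congrArg Subtype.val h⟩
  -- no two indices can be dropped at once
  have hsmall : ∀ j k, j ≠ k → ¬ ∀ z ∈ τ, ∃ i, i ≠ j ∧ i ≠ k ∧ m i = z := by
    intro j k hjk h
    have h1 : τ ⊆ ((univ.erase j).erase k).image m := by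
      intro z hz
      obtain ⟨i, h1, h2, h3⟩ := h z hz
      exact mem_image.2 ⟨i, by simp [h1, h2], h3⟩
    have h2 := (card_le_card h1).trans card_image_le
    rw [card_erase_of_mem (by simp [hjk.symm]), card_erase_of_mem (mem_univ _), card_univ] at h2
    have : 0 < #τ := hne.card_pos
    omega
  have hdisp : ∀ j, j = a ∨ j = b → ∀ z ∈ τ, ∃ i, i ≠ j ∧ m i = z := by
    intro j hj z hz
    obtain ⟨i, hi⟩ := hdom z
    have hi := hmem hz hi
    by_cases hij : i = j
    · rcases hj with rfl | rfl
      · exact ⟨b, hab.symm, by rw [← hmab, ← hij, hi]⟩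
      · exact ⟨a, hab, by rw [hmab, ← hij, hi]⟩
    · exact ⟨i, hij, hi⟩
  have hdisp' : ∀ j, (∀ z ∈ τ, ∃ i, i ≠ j ∧ m i = z) → j = a ∨ j = b := by
    intro j h
    by_contra! hj
    refine hsmall j a hj.1 fun z hz => ?_
    obtain ⟨i, hi, hiz⟩ := h z hz
    by_cases hia : i = a
    · exact ⟨b, hj.2.symm, hab.symm, by rw [← hmab, ← hia, hiz]⟩
    · exact ⟨i, hi, hia, hiz⟩
  have hmax : ∀ j, ∃ x, (∀ i, i ≠ j → r i (m i) < r i x) ∧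
      ∀ y, (∀ i, i ≠ j → r i (m i) < r i y) → r j y ≤ r j x := by
    intro j
    obtain ⟨y, hy⟩ := hM j
    obtain ⟨x, hx, hx'⟩ := ({y | ∀ i, i ≠ j → r i (m i) < r i y} : Finset W).exists_max_image
      (r j) ⟨y, by
        simp only [mem_filter, mem_univ, true_and]
        intro i hi
        obtain ⟨x, hx, hxy⟩ := hy i hi
        exact (hmin i x hx).trans_lt hxy⟩
    simp only [mem_filter, mem_univ, true_and] at hx hx'
    exact ⟨x, hx, hx'⟩
  choose p hp hpmax using hmax
  have key : ∀ x, (x ∉ τ ∧ Dominant r (insert x τ)) ↔ x = p a ∨ x = p b := by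
    intro x
    constructor
    · rintro ⟨hx, hD⟩
      have hK : ∀ z ∈ τ, ∃ i, r i (m i) < r i x ∧ m i = z := by
        intro z hz
        obtain ⟨i, hi⟩ := hD z
        have hiz : m i = z := hmem hz (hi _ (mem_insert_of_mem (hmτ i)))
        refine ⟨i, lt_of_le_of_ne (hiz ▸ hi x (mem_insert_self _ _)) fun h => hx ?_, hiz⟩
        rw [← hr i h]; exact hmτ i
      obtain ⟨j, hj⟩ := hdom x
      have hxM : ∀ i, i ≠ j → r i (m i) < r i x := by
        intro k hk
        by_contra! hk'
        refine hsmall j k hk.symm fun z hz => ?_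
        obtain ⟨i, hi, hiz⟩ := hK z hz
        refine ⟨i, ?_, ?_, hiz⟩
        · rintro rfl; omega
        · rintro rfl; omega
      have hxp : x = p j := by
        refine hr j (le_antisymm (hpmax j x hxM) ?_)
        obtain ⟨i, hi⟩ := hD (p j)
        by_cases hij : i = j
        · subst hij; exact hi x (mem_insert_self _ _)
        · exact absurd (hi _ (mem_insert_of_mem (hmτ i))) (not_le.2 (hp j i hij))
      have := hdisp' j fun z hz => by
        obtain ⟨i, hi, hiz⟩ := hK z hz
        exact ⟨i, by rintro rfl; omega, hiz⟩
      rcases this with rfl | rfl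
      · exact Or.inl hxp
      · exact Or.inr hxp
    · intro hx
      obtain ⟨j, hj, rfl⟩ : ∃ j, (j = a ∨ j = b) ∧ x = p j := by
        rcases hx with h | h
        · exact ⟨a, Or.inl rfl, h⟩
        · exact ⟨b, Or.inr rfl, h⟩
      refine ⟨fun hx => ?_, fun y => ?_⟩
      · obtain ⟨i, hi, hix⟩ := hdisp j hj _ hx
        have := hp j i hi
        rw [hix] at this
        exact lt_irrefl _ this
      · by_cases hy : ∀ i, i ≠ j → r i (m i) < r i y
        · refine ⟨j, fun x hx => ?_⟩
          rcases mem_insert.1 hx with rfl | hxτ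
          · exact hpmax j y hy
          · obtain ⟨i, hi⟩ := hdom y
            by_cases hij : i = j
            · subst hij; exact hi.trans (hmin _ x hxτ)
            · exact absurd hi (not_le.2 (hy i hij))
        · push Not at hy
          obtain ⟨i, hij, hi⟩ := hy
          refine ⟨i, fun x hx => ?_⟩
          rcases mem_insert.1 hx with rfl | hx
          · exact hi.trans (hp j i hij).le
          · exact hi.trans (hmin i x hx)
  have hpab : p a ≠ p b := by
    intro h
    obtain ⟨i, hi⟩ := hdom (p a)
    by_cases hia : i = a
    · have := hp b i (by rw [hia]; exact hab)
      rw [← h] at this; omega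
    · have := hp a i hia
      omega
  rw [show ({x | x ∉ τ ∧ Dominant r (insert x τ)} : Finset W) = {p a, p b} by
    ext x; simp [key x], card_pair hpab]

/-- A set with as many points as colours that misses a colour has an even number of facets
carrying precisely the colours other than `i₀`. -/
lemma even_card_facets [Fintype I] [DecidableEq I] [DecidableEq W] (c : W → I) (i₀ : I)
    {S : Finset W} (hS : #S = Fintype.card I) (hc : ∃ i, ∀ x ∈ S, c x ≠ i) :
    Even #{x ∈ S | (S.erase x).image c = univ.erase i₀} := by
  rcases eq_empty_or_nonempty {x ∈ S | (S.erase x).image c = univ.erase i₀} with h | ⟨x, hx⟩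
  · simp [h]
  obtain ⟨hxS, hx⟩ := mem_filter.1 hx
  have hinj : Set.InjOn c (S.erase x : Finset W) := by
    rw [← card_image_iff, hx, card_erase_of_mem (mem_univ _), card_erase_of_mem hxS, hS, card_univ]
  have hcx : c x ≠ i₀ := by
    rintro rfl
    obtain ⟨i, hi⟩ := hc
    have : i ∈ (S.erase x).image c := by
      rw [hx]; simpa using (hi x hxS).symm
    obtain ⟨y, hy, hyi⟩ := mem_image.1 this
    exact hi y (mem_of_mem_erase hy) hyi
  obtain ⟨x', hx', hcx'⟩ : ∃ x' ∈ S.erase x, c x' = c x := by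
    rw [← mem_image, hx]; simpa using hcx
  obtain ⟨hne, hx'S⟩ := mem_erase.1 hx'
  suffices {x ∈ S | (S.erase x).image c = univ.erase i₀} = {x, x'} by
    rw [this, card_pair hne.symm]; exact even_two
  ext y
  simp only [mem_filter, mem_insert, mem_singleton]
  constructor
  · rintro ⟨hyS, hy⟩
    by_contra! hyx
    have hy' : y ∈ S.erase x := mem_erase.2 ⟨hyx.1, hyS⟩
    have : c y ∈ (S.erase y).image c := by
      rw [hy, ← hx]; exact mem_image_of_mem c hy'
    obtain ⟨z, hz, hzy⟩ := mem_image.1 this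
    obtain ⟨hzy', hzS⟩ := mem_erase.1 hz
    by_cases hzx : z = x
    · subst hzx
      exact hyx.2 (hinj hy' hx' (by rw [hcx', hzy]))
    · exact hzy' (hinj (mem_erase.2 ⟨hzx, hzS⟩) hy' hzy)
  · rintro (rfl | rfl)
    · exact ⟨hxS, hx⟩
    · refine ⟨hx'S, ?_⟩
      rw [← hx]
      ext i
      simp only [mem_image, mem_erase]
      constructor
      · rintro ⟨z, ⟨hz, hzS⟩, rfl⟩
        by_cases hzx : z = x
        · subst hzx; exact ⟨y, ⟨hne, hx'S⟩, hcx'⟩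
        · exact ⟨z, ⟨hzx, hzS⟩, rfl⟩
      · rintro ⟨z, ⟨hz, hzS⟩, rfl⟩
        by_cases hzx : z = y
        · subst hzx; exact ⟨x, ⟨hne.symm, hxS⟩, hcx'.symm⟩
        · exact ⟨z, ⟨hzx, hzS⟩, rfl⟩

/-- Scarf's lemma. -/
lemma exists_rainbow_dominant [Fintype W] [Fintype I] [Nonempty I] {r : I → W → ℕ}
    (hr : ∀ i, Function.Injective (r i)) (s : I → W) (hs : ∃ w, ∀ i, w ≠ s i)
    (hmin : ∀ i w, r i (s i) ≤ r i w)
    (hmax : ∀ w, (∀ i, w ≠ s i) → ∀ i k, k ≠ i → r i w < r i (s k))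
    (c : W → I) (hcs : ∀ i, c (s i) = i) :
    ∃ S : Finset W, Dominant r S ∧ ∀ i, ∃ x ∈ S, c x = i := by
  classical
  by_contra! hcon
  obtain ⟨i₀⟩ := ‹Nonempty I›
  have hsinj : Function.Injective s := Function.LeftInverse.injective hcs
  set D : Finset (Finset W) :=
    {τ | #τ + 1 = Fintype.card I ∧ Dominant r τ ∧ τ.image c = univ.erase i₀} with hD
  set R : Finset (Finset W) := {S | #S = Fintype.card I ∧ Dominant r S} with hR
  have hcount : ∑ τ ∈ D, #{x | x ∉ τ ∧ Dominant r (insert x τ)} =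
      ∑ S ∈ R, #{x ∈ S | (S.erase x).image c = univ.erase i₀} := by
    rw [← card_sigma, ← card_sigma]
    refine card_nbij' (fun q => ⟨insert q.2 q.1, q.2⟩) (fun q => ⟨q.1.erase q.2, q.2⟩) ?_ ?_ ?_ ?_
    · rintro ⟨τ, x⟩ h
      simp only [hD, hR, coe_sigma, Set.mem_sigma_iff, mem_coe, mem_filter, mem_univ,
        true_and] at h ⊢
      obtain ⟨⟨h1, h2, h3⟩, h4, h5⟩ := h
      refine ⟨⟨by rw [card_insert_of_notMem h4, h1], h5⟩, mem_insert_self _ _, ?_⟩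
      rw [erase_insert h4, h3]
    · rintro ⟨S, x⟩ h
      simp only [hD, hR, coe_sigma, Set.mem_sigma_iff, mem_coe, mem_filter, mem_univ,
        true_and] at h ⊢
      obtain ⟨⟨h1, h2⟩, h4, h5⟩ := h
      exact ⟨⟨by rw [card_erase_add_one h4, h1], h2.mono (erase_subset _ _), h5⟩,
        notMem_erase _ _, by rwa [insert_erase h4]⟩
    · rintro ⟨τ, x⟩ h
      simp only [coe_sigma, Set.mem_sigma_iff, mem_coe, mem_filter, mem_univ,
        true_and] at h ⊢
      rw [erase_insert h.2.1]
    · rintro ⟨S, x⟩ h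
      simp only [coe_sigma, Set.mem_sigma_iff, mem_coe, mem_filter] at h ⊢
      rw [insert_erase h.2.1]
  have hRHS : Even (∑ S ∈ R, #{x ∈ S | (S.erase x).image c = univ.erase i₀}) := by
    refine even_sum _ fun S hS => ?_
    simp only [hR, mem_filter, mem_univ, true_and] at hS
    exact even_card_facets c i₀ hS.1 (hcon S hS.2)
  set τ₀ : Finset W := (univ.erase i₀).image s with hτ₀
  have hτ₀mem : ∀ k, k ≠ i₀ → s k ∈ τ₀ := fun k hk => mem_image_of_mem s (by simpa using hk)
  have hτ₀D : τ₀ ∈ D := by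
    simp only [hD, mem_filter, mem_univ, true_and]
    refine ⟨?_, ?_, ?_⟩
    · rw [card_image_of_injective _ hsinj, card_erase_add_one (mem_univ _), card_univ]
    · intro y
      by_cases hy : ∀ i, y ≠ s i
      · refine ⟨i₀, fun x hx => ?_⟩
        obtain ⟨k, hk, rfl⟩ := mem_image.1 hx
        exact (hmax y hy i₀ k (ne_of_mem_erase hk)).le
      · push Not at hy
        obtain ⟨k, rfl⟩ := hy
        exact ⟨k, fun x _ => hmin k x⟩
    · rw [hτ₀, image_image]
      simp [Function.comp_def, hcs]
  have hbdry : #{x | x ∉ τ₀ ∧ Dominant r (insert x τ₀)} = 1 := by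
    obtain ⟨w, hw⟩ := hs
    obtain ⟨p, hp, hpmax⟩ := ({y | ∀ i, y ≠ s i} : Finset W).exists_max_image (r i₀)
      ⟨w, by simpa using hw⟩
    simp only [mem_filter, mem_univ, true_and] at hp hpmax
    rw [card_eq_one]
    refine ⟨p, ?_⟩
    ext x
    simp only [mem_filter, mem_univ, true_and, mem_singleton]
    constructor
    · rintro ⟨hx, hdom⟩
      have hstrict : ∀ y, (∀ i, y ≠ s i) → r i₀ y ≤ r i₀ x := by
        intro y hy
        obtain ⟨i, hi⟩ := hdom y
        by_cases hii : i = i₀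
        · subst hii; exact hi x (mem_insert_self _ _)
        · exact absurd (hr i (le_antisymm (hi _ (mem_insert_of_mem (hτ₀mem i hii)))
            (hmin i y))) (hy i)
      have hxs : ∀ i, x ≠ s i := by
        rintro i rfl
        by_cases hii : i = i₀
        · subst hii
          exact hw i (hr i (le_antisymm (hstrict w hw) (hmin i w)))
        · exact hx (hτ₀mem i hii)
      exact hr i₀ (le_antisymm (hpmax x hxs) (hstrict p hp))
    · rintro rfl
      refine ⟨fun hx => ?_, fun y => ?_⟩
      · obtain ⟨k, -, hk⟩ := mem_image.1 hx
        exact hp k hk.symm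
      · by_cases hy : ∀ i, y ≠ s i
        · refine ⟨i₀, fun z hz => ?_⟩
          rcases mem_insert.1 hz with rfl | hz
          · exact hpmax y hy
          · obtain ⟨k, hk, rfl⟩ := mem_image.1 hz
            exact (hmax y hy i₀ k (ne_of_mem_erase hk)).le
        · push Not at hy
          obtain ⟨k, rfl⟩ := hy
          exact ⟨k, fun x _ => hmin k x⟩
  have hLHS : ∀ τ ∈ D.erase τ₀, Even #{x | x ∉ τ ∧ Dominant r (insert x τ)} := by
    intro τ hτ
    obtain ⟨hne, hτ⟩ := mem_erase.1 hτ
    simp only [hD, mem_filter, mem_univ, true_and] at hτ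
    obtain ⟨h1, h2, h3⟩ := hτ
    obtain ⟨v, hvτ, hv⟩ : ∃ v ∈ τ, ∀ i, v ≠ s i := by
      by_contra! hall
      refine hne (eq_of_subset_of_card_le (fun x hx => ?_) ?_)
      · obtain ⟨k, rfl⟩ := hall x hx
        refine hτ₀mem k ?_
        have : c (s k) ∈ τ.image c := mem_image_of_mem c hx
        rw [h3, hcs] at this
        exact ne_of_mem_erase this
      · rw [hτ₀, card_image_of_injective _ hsinj, card_erase_of_mem (mem_univ _), card_univ]
        omega
    rw [h2.card_extensions hr ⟨v, hvτ⟩ h1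
      fun j => ⟨s j, fun i hij => ⟨v, hvτ, hmax v hv i j hij.symm⟩⟩]
    exact even_two
  rw [← hcount, ← add_sum_erase D _ hτ₀D, hbdry] at hRHS
  have := even_sum _ hLHS
  rw [Nat.even_add] at hRHS
  exact Nat.not_even_one (hRHS.2 this)

end Scarf

section Brouwer

variable {ι : Type*} [Fintype ι]

/-- Scarf's lemma on the points of the simplex with denominator `N`. -/
lemma exists_grid_cell [Nonempty ι] [DecidableEq ι] (N : ℕ)
    (c : (piAntidiag (univ : Finset ι) N) → ι) :
    ∃ (p : ι → ℕ) (x : ι → ι → ℕ), ∑ i, p i = N ∧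
      (∀ i, x i ∈ piAntidiag (univ : Finset ι) N) ∧
      (∀ i k, x i k ≤ p k + Fintype.card ι ∧ p k ≤ x i k + Fintype.card ι) ∧
      ∀ i, (∃ h : x i ∈ piAntidiag (univ : Finset ι) N, c ⟨x i, h⟩ = i) ∨
        p i ≤ Fintype.card ι ∧ x i = p := by
  classical
  let V : Finset (ι → ℕ) := piAntidiag univ N
  have hV : ∀ x : V, ∑ i, x.1 i = N := fun x => (mem_piAntidiag.1 x.2).1
  have hmemV : ∀ x : ι → ℕ, ∑ i, x i = N → x ∈ V := fun x h =>
    mem_piAntidiag.2 ⟨h, fun i _ => mem_univ i⟩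
  let K := Fintype.card V
  let e : V ≃ Fin K := Fintype.equivFin V
  let e' : ι ≃ Fin (Fintype.card ι) := Fintype.equivFin ι
  have hlow : ∀ (x : V) i, x.1 i * K + (e x : ℕ) < (N + 1) * K := by
    intro x i
    have h1 : x.1 i ≤ N := by
      rw [← hV x]; exact single_le_sum (f := x.1) (fun _ _ => Nat.zero_le _) (mem_univ i)
    have h2 := (e x).2
    nlinarith
  have hcoord : ∀ (x y : V) i, x.1 i * K + (e x : ℕ) ≤ y.1 i * K + (e y : ℕ) →
      x.1 i ≤ y.1 i := by
    intro x y i h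
    by_contra! hlt
    have h2 := (e y).2
    nlinarith
  set r : ι → V ⊕ ι → ℕ := fun i => Sum.elim (fun x => x.1 i * K + (e x : ℕ) + 1)
    (fun k => if k = i then 0 else (N + 1) * K + 1 + (e' k : ℕ)) with hrdef
  have hr : ∀ i, Function.Injective (r i) := by
    rintro i (x | k) (y | l) h
    · simp only [hrdef, Sum.elim_inl] at h
      have h1 := hcoord x y i (by omega)
      have h2 := hcoord y x i (by omega)
      have h3 : x.1 i = y.1 i := le_antisymm h1 h2
      rw [h3] at h
      have : e x = e y := Fin.ext (by omega)
      rw [e.injective this]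
    · simp only [hrdef, Sum.elim_inl, Sum.elim_inr] at h
      have := hlow x i
      split_ifs at h
      all_goals omega
    · simp only [hrdef, Sum.elim_inl, Sum.elim_inr] at h
      have := hlow y i
      split_ifs at h
      all_goals omega
    · simp only [hrdef, Sum.elim_inr] at h
      split_ifs at h with h1 h2 h2
      · rw [h1, h2]
      · omega
      · omega
      · have : e' k = e' l := Fin.ext (by omega)
        rw [e'.injective this]
  have i₁ : ι := Classical.arbitrary ι
  have v₀ : V := ⟨Pi.single i₁ N, hmemV _ (by simp)⟩
  obtain ⟨S, hS, hrain⟩ := exists_rainbow_dominant hr Sum.inr ⟨Sum.inl v₀, by simp⟩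
    (fun i w => by simp [hrdef])
    (by
      rintro (x | k) hw i k' hk
      · have := hlow x i
        simp only [hrdef, Sum.elim_inl, Sum.elim_inr, if_neg hk]
        omega
      · exact absurd rfl (hw k))
    (Sum.elim c id) (fun i => rfl)
  set C : Finset ι := {i | Sum.inr i ∉ S} with hC
  have hCmem : ∀ {i}, i ∈ C ↔ Sum.inr i ∉ S := by simp [hC]
  have hdom : ∀ y : V, ∃ i ∈ C, ∀ x : V, Sum.inl x ∈ S → y.1 i ≤ x.1 i := by
    intro y
    obtain ⟨i, hi⟩ := hS (Sum.inl y)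
    refine ⟨i, hCmem.2 fun h => ?_, fun x hx => hcoord y x i ?_⟩
    · have := hi _ h
      simp [hrdef] at this
    · have := hi _ hx
      simpa [hrdef] using this
  have hcol : ∀ i ∈ C, ∃ x : V, Sum.inl x ∈ S ∧ c x = i := by
    intro i hi
    obtain ⟨x | k, hx, hxi⟩ := hrain i
    · exact ⟨x, hx, hxi⟩
    · simp only [Sum.elim_inr, id] at hxi
      exact absurd (hxi ▸ hx) (hCmem.1 hi)
  obtain ⟨i₀, hi₀, -⟩ := hdom v₀
  obtain ⟨p, hpS, -⟩ := hcol i₀ hi₀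
  have hfin : ∀ i, ∃ x : V, Sum.inl x ∈ S ∧ ∀ y : V, Sum.inl y ∈ S → x.1 i ≤ y.1 i := by
    intro i
    obtain ⟨x, hx, hx'⟩ := ({x | Sum.inl x ∈ S} : Finset V).exists_min_image (fun x => x.1 i)
      ⟨p, by simpa using hpS⟩
    simp only [mem_filter, mem_univ, true_and] at hx hx'
    exact ⟨x, hx, hx'⟩
  choose q hqS hqmin using hfin
  have hsum : N < ∑ i ∈ C, ((q i).1 i + 1) := by
    by_contra! hle
    set y : ι → ℕ := fun i => (if i ∈ C then (q i).1 i + 1 else 0) +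
      if i = i₀ then N - ∑ i ∈ C, ((q i).1 i + 1) else 0 with hy
    have hyV : y ∈ V := hmemV y (by
      rw [hy, sum_add_distrib, sum_ite_mem, univ_inter, sum_ite_eq' univ, if_pos (mem_univ _)]
      omega)
    obtain ⟨i, hi, hi'⟩ := hdom ⟨y, hyV⟩
    have := hi' (q i) (hqS i)
    simp only [hy, if_pos hi] at this
    omega
  rw [sum_add_distrib, sum_const, smul_eq_mul, mul_one] at hsum
  have hCcard : #C ≤ Fintype.card ι := card_le_univ C
  have hsplit : ∀ x : V, ∑ i ∈ C, x.1 i + ∑ i ∈ Cᶜ, x.1 i = N := fun x => by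
    rw [sum_add_sum_compl, hV]
  have hout : ∀ x : V, Sum.inl x ∈ S → ∀ k ∉ C, x.1 k ≤ Fintype.card ι := by
    intro x hx k hk
    have h1 : x.1 k ≤ ∑ i ∈ Cᶜ, x.1 i :=
      single_le_sum (f := x.1) (fun _ _ => Nat.zero_le _) (mem_compl.2 hk)
    have h2 : ∑ i ∈ C, (q i).1 i ≤ ∑ i ∈ C, x.1 i := sum_le_sum fun i _ => hqmin i x hx
    have := hsplit x
    omega
  have hin : ∀ x : V, Sum.inl x ∈ S → ∀ k ∈ C, x.1 k ≤ (q k).1 k + Fintype.card ι := by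
    intro x hx k hk
    have h2 : ∑ i ∈ C.erase k, (q i).1 i ≤ ∑ i ∈ C.erase k, x.1 i :=
      sum_le_sum fun i _ => hqmin i x hx
    have h3 := add_sum_erase C (fun i => (q i).1 i) hk
    have h4 := add_sum_erase C x.1 hk
    have := hsplit x
    omega
  have hclose : ∀ x y : V, Sum.inl x ∈ S → Sum.inl y ∈ S → ∀ k,
      x.1 k ≤ y.1 k + Fintype.card ι := by
    intro x y hx hy k
    by_cases hk : k ∈ C
    · exact (hin x hx k hk).trans (Nat.add_le_add_right (hqmin k y hy) _)
    · exact (hout x hx k hk).trans (Nat.le_add_left _ _)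
  have hx : ∀ i, ∃ x : V, Sum.inl x ∈ S ∧ (c x = i ∨ p.1 i ≤ Fintype.card ι ∧ x = p) := by
    intro i
    by_cases hi : i ∈ C
    · obtain ⟨x, hx, hxi⟩ := hcol i hi
      exact ⟨x, hx, Or.inl hxi⟩
    · exact ⟨p, hpS, Or.inr ⟨hout p hpS i hi, rfl⟩⟩
  choose x hxS hx using hx
  refine ⟨p.1, fun i => (x i).1, hV p, fun i => (x i).2, fun i k =>
    ⟨hclose _ _ (hxS i) hpS k, hclose _ _ hpS (hxS i) k⟩, fun i => ?_⟩
  exact (hx i).imp (fun h => ⟨(x i).2, h⟩) fun h => ⟨h.1, congrArg Subtype.val h.2⟩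

/-- Approximate form of Brouwer's theorem on the standard simplex. -/
lemma exists_approx_fixedPoint [Nonempty ι] {f : (ι → ℝ) → ι → ℝ}
    (hf : Set.MapsTo f (stdSimplex ℝ ι) (stdSimplex ℝ ι)) (N : ℕ) (hN : 0 < N) :
    ∃ p ∈ stdSimplex ℝ ι, ∃ x : ι → ι → ℝ, (∀ i, x i ∈ stdSimplex ℝ ι) ∧
      (∀ i k, |x i k - p k| ≤ Fintype.card ι / N) ∧
      ∀ i, x i i ≤ f (x i) i + Fintype.card ι / N := by
  classical
  have hN' : (0 : ℝ) < N := by exact_mod_cast hN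
  have hscale : ∀ y : ι → ℕ, ∑ i, y i = N → (fun i => (y i : ℝ) / N) ∈ stdSimplex ℝ ι := by
    intro y hy
    refine ⟨fun i => by positivity, ?_⟩
    rw [← sum_div, ← Nat.cast_sum, hy, div_self hN'.ne']
  have hsum : ∀ y : piAntidiag (univ : Finset ι) N, ∑ i, y.1 i = N := fun y =>
    (mem_piAntidiag.1 y.2).1
  have hcol : ∀ y : piAntidiag (univ : Finset ι) N, ∃ i,
      (y.1 i : ℝ) / N ≤ f (fun i => (y.1 i : ℝ) / N) i := by
    intro y
    have h1 := hscale y.1 (hsum y)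
    obtain ⟨i, -, hi⟩ := exists_le_of_sum_le (s := univ) univ_nonempty
      (h1.2.trans (hf h1).2.symm).le
    exact ⟨i, hi⟩
  choose c hc using hcol
  obtain ⟨p, x, hp, hx, hclose, hxc⟩ := exists_grid_cell N c
  refine ⟨_, hscale p hp, fun i k => (x i k : ℝ) / N,
    fun i => hscale (x i) (mem_piAntidiag.1 (hx i)).1, fun i k => ?_, fun i => ?_⟩
  · obtain ⟨h1, h2⟩ := hclose i k
    have h1' : (x i k : ℝ) ≤ p k + Fintype.card ι := by exact_mod_cast h1
    have h2' : (p k : ℝ) ≤ x i k + Fintype.card ι := by exact_mod_cast h2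
    rw [← sub_div, abs_div, abs_of_pos hN']
    gcongr
    rw [abs_le]
    constructor <;> linarith
  · rcases hxc i with ⟨h, hi⟩ | ⟨h, hi⟩
    · have := hc ⟨x i, h⟩
      rw [hi] at this
      have h0 : (0 : ℝ) ≤ Fintype.card ι / N := by positivity
      linarith
    · have h1 := (hf (hscale (x i) (mem_piAntidiag.1 (hx i)).1)).1 i
      have h2 : (x i i : ℝ) / N ≤ Fintype.card ι / N := by
        rw [hi]; gcongr
      simp only
      linarith

open Filter Topology in
/-- Brouwer's fixed point theorem on the standard simplex. -/
lemma exists_fixedPoint_stdSimplex [Nonempty ι] {f : (ι → ℝ) → ι → ℝ}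
    (hf : Set.MapsTo f (stdSimplex ℝ ι) (stdSimplex ℝ ι))
    (hfc : ContinuousOn f (stdSimplex ℝ ι)) : ∃ x ∈ stdSimplex ℝ ι, f x = x := by
  choose p hp x hx hclose hle using fun n : ℕ => exists_approx_fixedPoint hf (n + 1) n.succ_pos
  obtain ⟨q, hq, φ, hφ, hlim⟩ := (isCompact_stdSimplex ℝ ι).tendsto_subseq hp
  have herr : Tendsto (fun n => (Fintype.card ι : ℝ) / ((φ n + 1 : ℕ) : ℝ)) atTop (𝓝 0) :=
    (tendsto_const_div_atTop_nhds_zero_nat (Fintype.card ι : ℝ)).comp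
      ((tendsto_add_atTop_nat 1).comp hφ.tendsto_atTop)
  have hxlim : ∀ i, Tendsto (fun n => x (φ n) i) atTop (𝓝 q) := by
    intro i
    rw [tendsto_pi_nhds]
    intro k
    have h1 : Tendsto (fun n => x (φ n) i k - p (φ n) k) atTop (𝓝 0) :=
      squeeze_zero_norm (fun n => hclose (φ n) i k) herr
    simpa using h1.add (tendsto_pi_nhds.1 hlim k)
  have hqle : ∀ i, q i ≤ f q i := by
    intro i
    have h1 : Tendsto (fun n => f (x (φ n) i)) atTop (𝓝 (f q)) :=
      (hfc q hq).tendsto.comp (tendsto_nhdsWithin_iff.2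
        ⟨hxlim i, Eventually.of_forall fun n => hx (φ n) i⟩)
    have h2 := (tendsto_pi_nhds.1 h1 i).add herr
    rw [add_zero] at h2
    exact le_of_tendsto_of_tendsto' (tendsto_pi_nhds.1 (hxlim i) i) h2
      fun n => hle (φ n) i
  refine ⟨q, hq, ?_⟩
  have := (sum_eq_sum_iff_of_le fun i _ => hqle i).1 (hq.2.trans (hf hq).2.symm)
  exact funext fun i => (this i (mem_univ i)).symm

end Brouwer

section Response

variable {A : Type*} [Fintype A]

/-- Unnormalised weight of `a` in `quasiResponse`. -/
noncomputable def quasiWeight (δ : ℝ) (v : A → ℝ) (a : A) : ℝ :=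
  δ ^ 2 + max 0 (δ - ∑ b, max 0 (v b - v a))

/-- A totally mixed, continuous approximate best reply to the payoff vector `v`. -/
noncomputable def quasiResponse (δ : ℝ) (v : A → ℝ) (a : A) : ℝ :=
  quasiWeight δ v a / ∑ b, quasiWeight δ v b

lemma sq_le_quasiWeight (δ : ℝ) (v : A → ℝ) (a : A) : δ ^ 2 ≤ quasiWeight δ v a :=
  le_add_of_nonneg_right (le_max_left _ _)

lemma quasiWeight_le {δ : ℝ} (hδ : 0 ≤ δ) (v : A → ℝ) (a : A) :
    quasiWeight δ v a ≤ δ ^ 2 + δ := by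
  have : 0 ≤ ∑ b, max 0 (v b - v a) := sum_nonneg fun _ _ => le_max_left _ _
  exact add_le_add_right (max_le hδ (by linarith)) _

lemma quasiWeight_eq_sq {δ : ℝ} {v : A → ℝ} {a b : A} (h : v b + δ ≤ v a) :
    quasiWeight δ v b = δ ^ 2 := by
  have : v a - v b ≤ ∑ c, max 0 (v c - v b) := (le_max_right 0 _).trans
    (single_le_sum (f := fun c => max 0 (v c - v b)) (fun _ _ => le_max_left _ _) (mem_univ a))
  rw [quasiWeight, max_eq_left (by linarith), add_zero]

lemma le_sum_quasiWeight [Nonempty A] {δ : ℝ} (v : A → ℝ) : δ ≤ ∑ b, quasiWeight δ v b := by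
  obtain ⟨a, ha⟩ := Finite.exists_max v
  have h : quasiWeight δ v a = δ ^ 2 + max 0 δ := by
    rw [quasiWeight, sum_eq_zero fun b _ => max_eq_left (sub_nonpos.2 (ha b)), sub_zero]
  calc δ ≤ quasiWeight δ v a := by
        rw [h]; exact (le_max_right 0 δ).trans (le_add_of_nonneg_left (sq_nonneg δ))
    _ ≤ ∑ b, quasiWeight δ v b := single_le_sum
        (fun b _ => (sq_nonneg δ).trans (sq_le_quasiWeight δ v b)) (mem_univ a)

variable [Nonempty A] {δ : ℝ}

lemma quasiResponse_mem_stdSimplex (hδ : 0 < δ) (v : A → ℝ) :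
    quasiResponse δ v ∈ stdSimplex ℝ A := by
  have h := hδ.trans_le (le_sum_quasiWeight v)
  refine ⟨fun a => div_nonneg ((sq_nonneg δ).trans (sq_le_quasiWeight δ v a)) h.le, ?_⟩
  simp only [quasiResponse]
  rw [← sum_div, div_self h.ne']

lemma le_quasiResponse (hδ : 0 < δ) (hδ1 : δ ≤ 1) (v : A → ℝ) (a : A) :
    δ / (2 * Fintype.card A) ≤ quasiResponse δ v a := by
  have h := hδ.trans_le (le_sum_quasiWeight v)
  have hA : (0 : ℝ) < Fintype.card A := by exact_mod_cast Fintype.card_pos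
  have h1 : ∑ b, quasiWeight δ v b ≤ Fintype.card A * (2 * δ) := by
    have := sum_le_card_nsmul univ (quasiWeight δ v) (2 * δ)
      fun b _ => (quasiWeight_le hδ.le v b).trans (by nlinarith)
    simpa using this
  calc δ / (2 * Fintype.card A) = δ ^ 2 / (Fintype.card A * (2 * δ)) := by field_simp
    _ ≤ quasiResponse δ v a := by
      unfold quasiResponse
      exact div_le_div₀ ((sq_nonneg δ).trans (sq_le_quasiWeight δ v a))
        (sq_le_quasiWeight δ v a) h h1

lemma quasiResponse_le (hδ : 0 < δ) {v : A → ℝ} {a b : A} (h : v b + δ ≤ v a) :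
    quasiResponse δ v b ≤ δ := by
  rw [quasiResponse, quasiWeight_eq_sq h,
    div_le_iff₀ (hδ.trans_le (le_sum_quasiWeight v)), sq]
  exact mul_le_mul_of_nonneg_left (le_sum_quasiWeight v) hδ.le

lemma continuous_quasiResponse (hδ : 0 < δ) :
    Continuous (quasiResponse δ : (A → ℝ) → A → ℝ) := by
  refine continuous_pi fun a => Continuous.div ?_ ?_
    fun v => (hδ.trans_le (le_sum_quasiWeight v)).ne'
  · unfold quasiWeight; fun_prop
  · unfold quasiWeight; fun_prop

end Response

section Existence

variable {T A : Type*} [Fintype T] [Fintype A]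

lemma exists_approx_perceptionEqm [Nonempty T] [Nonempty A] {β : T → ℝ}
    (hβ : β ∈ stdSimplex ℝ T) {u : T → A → (T → ℝ) → ℝ}
    (hu : ∀ t a, ContinuousOn (u t a) (stdSimplex ℝ T)) {δ : ℝ} (hδ : 0 < δ) (hδ1 : δ ≤ 1) :
    ∃ (σ : T → A → ℝ) (μ : A → T → ℝ), (∀ t, σ t ∈ stdSimplex ℝ A) ∧
      (∀ a, μ a ∈ stdSimplex ℝ T) ∧ (∀ a t, μ a t * actProb β σ a = β t * σ t a) ∧
      ∀ t a b, u t b (μ b) + δ ≤ u t a (μ a) → σ t b ≤ δ := by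
  have hT : (0 : ℝ) < Fintype.card T := by exact_mod_cast Fintype.card_pos
  have hA : (0 : ℝ) < Fintype.card A := by exact_mod_cast Fintype.card_pos
  have hκ : 0 < δ / (2 * Fintype.card A) := by positivity
  let g : (T × A → ℝ) → T → A → ℝ := fun x t a =>
    max (Fintype.card T * x (t, a)) (δ / (2 * Fintype.card A))
  have hg : ∀ x t a, δ / (2 * Fintype.card A) ≤ g x t a := fun x t a => le_max_right _ _
  have hden : ∀ x a, 0 < actProb β (g x) a := fun x a => by
    refine hκ.trans_le ?_
    calc δ / (2 * Fintype.card A) = ∑ t, β t * (δ / (2 * Fintype.card A)) := by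
          rw [← sum_mul, hβ.2, one_mul]
      _ ≤ actProb β (g x) a :=
        sum_le_sum fun t _ => mul_le_mul_of_nonneg_left (hg x t a) (hβ.1 t)
  let μ : (T × A → ℝ) → A → T → ℝ := fun x a t => β t * g x t a / actProb β (g x) a
  have hμ : ∀ x a, μ x a ∈ stdSimplex ℝ T := fun x a => by
    refine ⟨fun t => div_nonneg (mul_nonneg (hβ.1 t) (hκ.le.trans (hg x t a))) (hden x a).le, ?_⟩
    simp only [μ]
    rw [← sum_div]
    exact div_self (hden x a).ne'
  have hμc : ∀ a, Continuous fun x => μ x a := fun a => by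
    refine continuous_pi fun t => Continuous.div ?_ ?_ fun x => (hden x a).ne'
    · simp only [g]; fun_prop
    · simp only [g, actProb]; fun_prop
  let R : (T × A → ℝ) → T → A → ℝ := fun x t => quasiResponse δ fun a => u t a (μ x a)
  have hR : ∀ x t, R x t ∈ stdSimplex ℝ A := fun x t => quasiResponse_mem_stdSimplex hδ _
  have hRc : ∀ t, Continuous fun x => R x t := fun t =>
    (continuous_quasiResponse hδ).comp (continuous_pi fun a =>
      (hu t a).comp_continuous (hμc a) fun x => hμ x a)
  obtain ⟨x, -, hx⟩ := exists_fixedPoint_stdSimplex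
    (f := fun x (q : T × A) => R x q.1 q.2 / Fintype.card T)
    (fun x _ => by
      refine ⟨fun q => div_nonneg ((hR x q.1).1 q.2) hT.le, ?_⟩
      rw [Fintype.sum_prod_type]
      simp only [← sum_div, (hR x _).2]
      simp [hT.ne'])
    (Continuous.continuousOn (continuous_pi fun q =>
      ((continuous_apply q.2).comp (hRc q.1)).div_const _))
  have hgx : g x = R x := by
    funext t a
    have h : Fintype.card T * x (t, a) = R x t a := by
      have := congrFun hx (t, a)
      rw [← this]
      field_simp
    simp only [g, h]
    exact max_eq_left (le_quasiResponse hδ hδ1 _ a)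
  refine ⟨R x, μ x, hR x, hμ x, fun a t => ?_, fun t a b h => quasiResponse_le hδ h⟩
  rw [← hgx]
  exact div_mul_cancel₀ _ (hden x a).ne'

open Filter Topology in
lemma exists_posterior_eqm [Nonempty T] [Nonempty A] {β : T → ℝ}
    (hβ : β ∈ stdSimplex ℝ T) {u : T → A → (T → ℝ) → ℝ}
    (hu : ∀ t a, ContinuousOn (u t a) (stdSimplex ℝ T)) :
    ∃ (σ : T → A → ℝ) (μ : A → T → ℝ), (∀ t, σ t ∈ stdSimplex ℝ A) ∧
      (∀ a, μ a ∈ stdSimplex ℝ T) ∧ (∀ a t, μ a t * actProb β σ a = β t * σ t a) ∧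
      ∀ t a b, u t b (μ b) < u t a (μ a) → σ t b = 0 := by
  have hδ : ∀ n : ℕ, (0 : ℝ) < 1 / (n + 1) := fun n => Nat.one_div_pos_of_nat
  have hδ1 : ∀ n : ℕ, (1 : ℝ) / (n + 1) ≤ 1 := fun n => by
    rw [div_le_one (by positivity)]
    exact le_add_of_nonneg_left n.cast_nonneg
  choose σ μ hσ hμ hbayes hopt using fun n => exists_approx_perceptionEqm hβ hu (hδ n) (hδ1 n)
  have hcompact : IsCompact
      ((Set.univ.pi fun _ : T => stdSimplex ℝ A) ×ˢ Set.univ.pi fun _ : A => stdSimplex ℝ T) :=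
    (isCompact_univ_pi fun _ => isCompact_stdSimplex ℝ A).prod
      (isCompact_univ_pi fun _ => isCompact_stdSimplex ℝ T)
  obtain ⟨⟨σ', μ'⟩, ⟨hσ', hμ'⟩, φ, hφ, hlim⟩ := hcompact.tendsto_subseq
    (x := fun n => (σ n, μ n)) fun n => ⟨fun t _ => hσ n t, fun a _ => hμ n a⟩
  have hσlim : ∀ t a, Tendsto (fun n => σ (φ n) t a) atTop (𝓝 (σ' t a)) := fun t a =>
    tendsto_pi_nhds.1 (tendsto_pi_nhds.1 hlim.fst_nhds t) a
  have hμlim : ∀ a, Tendsto (fun n => μ (φ n) a) atTop (𝓝 (μ' a)) := fun a =>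
    tendsto_pi_nhds.1 hlim.snd_nhds a
  have hδlim : Tendsto (fun n => (1 : ℝ) / ((φ n : ℝ) + 1)) atTop (𝓝 0) :=
    tendsto_one_div_add_atTop_nhds_zero_nat.comp hφ.tendsto_atTop
  have hulim : ∀ t a, Tendsto (fun n => u t a (μ (φ n) a)) atTop (𝓝 (u t a (μ' a))) :=
    fun t a => (hu t a _ (hμ' a trivial)).tendsto.comp
      (tendsto_nhdsWithin_iff.2 ⟨hμlim a, Eventually.of_forall fun n => hμ _ a⟩)
  refine ⟨σ', μ', fun t => hσ' t trivial, fun a => hμ' a trivial, fun a t => ?_,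
    fun t a b hab => ?_⟩
  · have h1 : Tendsto (fun n => actProb β (σ (φ n)) a) atTop (𝓝 (actProb β σ' a)) :=
      tendsto_finsetSum _ fun t _ => (hσlim t a).const_mul (β t)
    refine tendsto_nhds_unique ((tendsto_pi_nhds.1 (hμlim a) t).mul h1) ?_
    simp only [hbayes]
    exact (hσlim t a).const_mul (β t)
  · refine le_antisymm ?_ ((hσ' t trivial).1 b)
    have h1 := (hulim t b).add hδlim
    rw [add_zero] at h1
    refine le_of_tendsto_of_tendsto (hσlim t b) hδlim ?_
    filter_upwards [h1.eventually_lt (hulim t a) hab] with n hn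
    exact hopt _ t a b hn.le

end Existence

/-- existence of a perception equilibrium in any finite
single-player perception game with utility continuous in the perception. -/
theorem exists_perception_equilibrium
    {T A : Type*} [Fintype T] [Fintype A] [Nonempty T] [Nonempty A]
    (β : T → ℝ) (hβ : β ∈ stdSimplex ℝ T)
    (u : T → A → (T → ℝ) → ℝ)
    (hu : ∀ t a, ContinuousOn (u t a) (stdSimplex ℝ T)) :
    ∃ (σ : T → A → ℝ) (τ : T → A → T → ℝ), PerceptionEqm β u σ τ := by
  obtain ⟨σ, μ, hσ, hμ, hbayes, hopt⟩ := exists_posterior_eqm hβ hu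
  refine ⟨σ, fun _ => μ, hσ, fun _ => hμ, fun a ha t tb => ?_, fun t s hs => ?_⟩
  · rw [eq_div_iff ha.ne', hbayes]
  · obtain ⟨m, hm⟩ := Finite.exists_max fun a => u t a (μ a)
    calc ExpUtil u (fun _ => μ) t s ≤ ∑ a, s a * u t m (μ m) :=
          sum_le_sum fun a _ => mul_le_mul_of_nonneg_left (hm a) (hs.1 a)
      _ = ∑ a, σ t a * u t m (μ m) := by rw [← sum_mul, ← sum_mul, hs.2, (hσ t).2]
      _ = ExpUtil u (fun _ => μ) t (σ t) := sum_congr rfl fun a _ => by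
        rcases (hm a).lt_or_eq with h | h
        · rw [hopt t m a h, zero_mul, zero_mul]
        · rw [h]
end

section
/- In any finite two-player perception game (T_i, A_i, β_i, u_i)_{i=1,2} in which each u_i : T_i × T_{-i} × A_i × A_{-i} × Δ(T_i) → ℝ is continuous in its last argument, there exists a perception equilibrium: strategies σ_i : T_i → Δ(A_i) and perceptions τ_i : T_i × T_{-i} × A_i → Δ(T_i), i = 1, 2, such that each player is Bayesian-consistent and each type of each player best-replies. -/
open Finset

open MeasureTheory in
/-- If `t ↦ f t x` is polynomial of degree `≤ N` for every `x`, and `∫ f t` is constant for small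
positive `t`, then it has the same value for all `t`. -/
theorem integral_eq_of_eventually_eq_of_polynomial {X : Type*} [MeasurableSpace X] {μ : Measure X}
    {f : ℝ → X → ℝ} {N : ℕ} {δ c : ℝ} (hδ : 0 < δ) (hint : ∀ t, Integrable (f t) μ)
    (hpoly : ∀ x, ∃ p : Polynomial ℝ, p.natDegree ≤ N ∧ ∀ t, p.eval t = f t x)
    (hconst : ∀ t, 0 < t → t < δ → ∫ x, f t x ∂μ = c) (s : ℝ) :
    ∫ x, f s x ∂μ = c := by
  set v : ℕ → ℝ := fun i ↦ δ / (i + 2) with hv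
  have hv0 : ∀ i, 0 < v i := fun i ↦ by positivity
  have hvδ : ∀ i, v i < δ := fun i ↦ by
    have : (0 : ℝ) ≤ i := i.cast_nonneg
    exact div_lt_self hδ (by linarith)
  have hinj : Set.InjOn v (Finset.range (N + 1)) := by
    intro i _ j _ h
    have hi : (i : ℝ) + 2 ≠ 0 := by positivity
    have hj : (j : ℝ) + 2 ≠ 0 := by positivity
    simp only [hv] at h
    field_simp at h
    exact_mod_cast (add_right_cancel h).symm
  set w : ℕ → ℝ := fun i ↦ (Lagrange.basis (Finset.range (N + 1)) v i).eval s
  have hw : ∑ i ∈ Finset.range (N + 1), w i = 1 := by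
    rw [← Polynomial.eval_finsetSum, Lagrange.sum_basis hinj (by simp), Polynomial.eval_one]
  have hf : f s = fun x ↦ ∑ i ∈ Finset.range (N + 1), f (v i) x * w i := by
    ext x
    obtain ⟨p, hp, hpe⟩ := hpoly x
    have hdeg : p.degree < #(Finset.range (N + 1)) := by
      rw [card_range]
      exact (Polynomial.degree_le_of_natDegree_le hp).trans_lt (by exact_mod_cast Nat.lt_succ_self N)
    rw [← hpe, Lagrange.eq_interpolate hinj hdeg, Lagrange.interpolate_apply,
      Polynomial.eval_finsetSum]
    simp [hpe, w]
  rw [hf, integral_finsetSum _ fun i _ ↦ (hint _).mul_const _]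
  simp_rw [integral_mul_const, hconst _ (hv0 _) (hvδ _), ← Finset.mul_sum, hw, mul_one]

theorem exists_polynomial_eval_eq_det_one_sub_smul {E : Type*} [NormedAddCommGroup E]
    [NormedSpace ℝ E] [FiniteDimensional ℝ E] (A : E →L[ℝ] E) :
    ∃ p : Polynomial ℝ, p.natDegree ≤ Module.finrank ℝ E ∧
      ∀ t : ℝ, p.eval t = (1 - t • A).det := by
  let b := Module.finBasis ℝ E
  let M := LinearMap.toMatrix b b (A : E →ₗ[ℝ] E)
  refine ⟨_, (Polynomial.natDegree_det_X_add_C_le (-M) 1).trans_eq (Fintype.card_fin _),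
    fun t ↦ ?_⟩
  rw [← Polynomial.coe_evalRingHom, RingHom.map_det, ContinuousLinearMap.det,
    ← LinearMap.det_toMatrix b]
  congr 1
  ext i j
  simp [M, LinearMap.toMatrix_apply, Matrix.one_apply, sub_eq_add_neg, add_comm,
    Finsupp.single_apply, eq_comm]
  split_ifs <;> simp [mul_comm]

theorem exists_polynomial_eval_eq_sub_norm_sq_pow {E : Type*} [NormedAddCommGroup E]
    [InnerProductSpace ℝ E] (x y : E) (c : ℝ) (k : ℕ) :
    ∃ p : Polynomial ℝ, p.natDegree ≤ k * 2 ∧ ∀ t : ℝ, p.eval t = (c - ‖x - t • y‖ ^ 2) ^ k := by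
  open Polynomial in
  refine ⟨(C (c - ‖x‖ ^ 2) + C (2 * inner ℝ x y) * X - C (‖y‖ ^ 2) * X ^ 2) ^ k,
    natDegree_pow_le_of_le k (by compute_degree), fun t ↦ ?_⟩
  rw [norm_sub_sq_real, norm_smul, inner_smul_right, mul_pow, Real.norm_eq_abs, sq_abs]
  simp
  ring

open MeasureTheory Metric in
/-- A small perturbation of the identity that is trivial outside a ball preserves the integral
over that ball. -/
theorem exists_forall_integral_comp_sub_smul_eq {E : Type*} [NormedAddCommGroup E]
    [NormedSpace ℝ E] [FiniteDimensional ℝ E] [MeasurableSpace E] [BorelSpace E]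
    (μ : Measure E) [μ.IsAddHaarMeasure] {g : E → E} {R : ℝ} (hg : ContDiff ℝ 1 g)
    (hsupp : ∀ x ∉ closedBall (0 : E) R, g x = 0) :
    ∃ δ > 0, ∀ t : ℝ, 0 < t → t < δ → ∀ φ : E → ℝ,
      ∫ x in closedBall 0 R, φ (x - t • g x) * (1 - t • fderiv ℝ g x).det ∂μ =
        ∫ x in closedBall 0 R, φ x ∂μ := by
  have hcs : HasCompactSupport g := .intro (isCompact_closedBall 0 R) hsupp
  obtain ⟨K, hK⟩ := hg.lipschitzWith_of_hasCompactSupport hcs one_ne_zero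
  have hpos : ∀ᶠ A : E →L[ℝ] E in nhds 1, 0 < A.det :=
    ContinuousLinearMap.continuous_det.continuousAt.eventually
      (lt_mem_nhds (by simp [ContinuousLinearMap.det]))
  obtain ⟨η, hη, hdet⟩ := Metric.eventually_nhds_iff.1 hpos
  refine ⟨min η 1 / (K + 1), by positivity, fun t ht htδ φ ↦ ?_⟩
  rw [lt_div_iff₀ (by positivity)] at htδ
  have htK : t * K < min η 1 := lt_of_le_of_lt (by nlinarith) htδ
  have hcontr : ∀ y, ContractingWith (t.toNNReal * K) (fun x ↦ y + t • g x) := fun y ↦ by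
    refine ⟨?_, LipschitzWith.of_dist_le_mul fun a b ↦ ?_⟩
    · rw [← NNReal.coe_lt_coe]
      simpa [ht.le] using htK.trans_le (min_le_right _ _)
    · rw [dist_add_left, dist_smul₀, NNReal.coe_mul, Real.coe_toNNReal _ ht.le, Real.norm_eq_abs,
        abs_of_pos ht, mul_assoc]
      gcongr
      exact hK.dist_le_mul a b
  have hinj : Function.Injective fun x ↦ x - t • g x := fun a b hab ↦ by
    have hab : a - t • g a = b - t • g b := hab
    refine (hcontr (a - t • g a)).fixedPoint_unique' (x := a) (y := b) ?_ ?_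
    · simp [Function.IsFixedPt]
    · simp [Function.IsFixedPt, hab]
  have himage : (fun x ↦ x - t • g x) '' closedBall 0 R = closedBall 0 R := by
    apply Set.Subset.antisymm
    · rintro _ ⟨x, hx, rfl⟩
      by_contra hy
      have h := @hinj (x - t • g x) x (by simp [hsupp _ hy])
      exact hy (Set.mem_of_eq_of_mem h hx)
    · intro y hy
      obtain ⟨x, hx⟩ : ∃ x, Function.IsFixedPt (fun x ↦ y + t • g x) x :=
        ⟨_, (hcontr y).fixedPoint_isFixedPt⟩
      have hxy : x - t • g x = y := by rw [sub_eq_iff_eq_add]; exact hx.symm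
      refine ⟨x, ?_, hxy⟩
      by_contra hx'
      rw [hsupp x hx', smul_zero, sub_zero] at hxy
      exact hx' (hxy ▸ hy)
  have hderiv : ∀ x, HasFDerivAt (fun x ↦ x - t • g x) (1 - t • fderiv ℝ g x) x := fun x ↦
    (hasFDerivAt_id x).sub ((hg.differentiable one_ne_zero x).hasFDerivAt.const_smul t)
  have key := integral_image_eq_integral_abs_det_fderiv_smul μ measurableSet_closedBall
    (fun x _ ↦ (hderiv x).hasFDerivWithinAt) hinj.injOn φ (s := closedBall 0 R)
  rw [himage] at key
  rw [key]
  refine integral_congr_ae (.of_forall fun x ↦ ?_)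
  have : 0 < (1 - t • fderiv ℝ g x).det := by
    apply hdet
    rw [dist_eq_norm, sub_sub_cancel_left, norm_neg, norm_smul, Real.norm_of_nonneg ht.le]
    calc t * ‖fderiv ℝ g x‖ ≤ t * K := by gcongr; exact norm_fderiv_le_of_lipschitz ℝ hK
      _ < η := htK.trans_le (min_le_left _ _)
  simp [abs_of_pos this, mul_comm]

open MeasureTheory Metric in
theorem ContDiff.exists_isFixedPt_of_hasCompactSupport {E : Type*} [NormedAddCommGroup E]
    [InnerProductSpace ℝ E] [FiniteDimensional ℝ E] {g : E → E} (hg : ContDiff ℝ 1 g)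
    (hcs : HasCompactSupport g) : ∃ x, g x = x := by
  borelize E
  let μ : Measure E := .addHaar
  by_contra! hne
  obtain ⟨R, hR, hsupp⟩ : ∃ R > 0, ∀ x ∉ closedBall (0 : E) R, g x = 0 := by
    obtain ⟨R, hR, h⟩ := hcs.isCompact.isBounded.subset_closedBall_lt 0 0
    exact ⟨R, hR, fun x hx ↦ image_eq_zero_of_notMem_tsupport fun h' ↦ hx (h h')⟩
  set B := closedBall (0 : E) R with hB
  have hBc : IsCompact B := isCompact_closedBall 0 R
  have hBne : B.Nonempty := ⟨0, by simp [hB, hR.le]⟩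
  have hgc : Continuous g := hg.continuous
  have hdc : ∀ t : ℝ, Continuous fun x ↦ (1 - t • fderiv ℝ g x).det := fun t ↦
    ContinuousLinearMap.continuous_det.comp
      (continuous_const.sub ((hg.continuous_fderiv one_ne_zero).const_smul t))
  have key : ∀ (c : ℝ) (k : ℕ),
      ∫ x in B, (c - ‖x - (1 : ℝ) • g x‖ ^ 2) ^ k * (1 - (1 : ℝ) • fderiv ℝ g x).det ∂μ =
        ∫ x in B, (c - ‖x‖ ^ 2) ^ k ∂μ := by
    intro c k
    obtain ⟨δ, hδ, h⟩ := exists_forall_integral_comp_sub_smul_eq μ hg hsupp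
    refine integral_eq_of_eventually_eq_of_polynomial (N := k * 2 + Module.finrank ℝ E)
      (f := fun t x ↦ (c - ‖x - t • g x‖ ^ 2) ^ k * (1 - t • fderiv ℝ g x).det)
      hδ (fun t ↦ ?_) (fun x ↦ ?_) (fun t ht htδ ↦ h t ht htδ fun y ↦ (c - ‖y‖ ^ 2) ^ k) 1
    · exact (Continuous.mul (by fun_prop) (hdc t)).continuousOn.integrableOn_compact hBc
    · obtain ⟨p, hp, hpe⟩ := exists_polynomial_eval_eq_sub_norm_sq_pow x (g x) c k
      obtain ⟨q, hq, hqe⟩ := exists_polynomial_eval_eq_det_one_sub_smul (fderiv ℝ g x)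
      exact ⟨p * q, Polynomial.natDegree_mul_le_of_le hp hq, fun t ↦ by simp [hpe, hqe]⟩
  simp only [one_smul] at key
  obtain ⟨x₀, -, hx₀⟩ := hBc.exists_isMinOn hBne
    (Continuous.continuousOn (f := fun x ↦ ‖x - g x‖) (by fun_prop))
  obtain ⟨x₁, -, hx₁⟩ := hBc.exists_isMaxOn hBne
    (Continuous.continuousOn (f := fun x ↦ ‖x - g x‖) (by fun_prop))
  obtain ⟨D, hD⟩ := hBc.exists_bound_of_continuousOn (hdc 1).continuousOn
  simp only [one_smul] at hD
  set r := min ‖x₀ - g x₀‖ R with hr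
  have hr0 : 0 < r := lt_min (norm_pos_iff.2 (sub_ne_zero.2 (hne x₀).symm)) hR
  set m := max ‖x₁ - g x₁‖ R with hm
  have hlow : ∀ x ∈ B, r ≤ ‖x - g x‖ := fun x hx ↦ (min_le_left _ _).trans (hx₀ hx)
  have hupp : ∀ x ∈ B, ‖x - g x‖ ≤ m := fun x hx ↦ (hx₁ hx).trans (le_max_left _ _)
  have hRm : R ≤ m := le_max_right _ _
  have hrR : r ≤ R := min_le_right _ _
  set a := m ^ 2 - r ^ 2 with ha
  set b := m ^ 2 - (r / 2) ^ 2 with hb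
  have ha0 : 0 ≤ a := by simp only [ha]; nlinarith
  have hab : a < b := by simp only [ha, hb]; nlinarith
  have hupper : ∀ k : ℕ, ∫ x in B, (m ^ 2 - ‖x‖ ^ 2) ^ k ∂μ ≤ a ^ k * D * μ.real B := by
    intro k
    rw [← key]
    refine (Real.le_norm_self _).trans ?_
    refine norm_setIntegral_le_of_norm_le_const hBc.measure_lt_top fun x hx ↦ ?_
    have h1 := hlow x hx
    have h2 := hupp x hx
    have h3 : 0 ≤ m ^ 2 - ‖x - g x‖ ^ 2 := by nlinarith [norm_nonneg (x - g x)]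
    rw [norm_mul, norm_pow, Real.norm_of_nonneg h3]
    gcongr
    · simp only [ha]; gcongr
    · exact hD x hx
  have hlower : ∀ k : ℕ, b ^ k * μ.real (closedBall 0 (r / 2)) ≤
      ∫ x in B, (m ^ 2 - ‖x‖ ^ 2) ^ k ∂μ := by
    intro k
    have hsub : closedBall (0 : E) (r / 2) ⊆ B := closedBall_subset_closedBall (by linarith)
    have hint : IntegrableOn (fun x ↦ (m ^ 2 - ‖x‖ ^ 2) ^ k) B μ :=
      (Continuous.continuousOn (by fun_prop)).integrableOn_compact hBc
    have hnn : ∀ x ∈ B, 0 ≤ (m ^ 2 - ‖x‖ ^ 2) ^ k := fun x hx ↦ by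
      have : ‖x‖ ≤ m := (mem_closedBall_zero_iff.1 hx).trans hRm
      exact pow_nonneg (by nlinarith [norm_nonneg x]) k
    refine le_trans ?_ (setIntegral_mono_set hint
      (ae_restrict_of_forall_mem measurableSet_closedBall hnn) hsub.eventuallyLE)
    rw [mul_comm, ← smul_eq_mul, ← setIntegral_const]
    refine setIntegral_mono_on (integrableOn_const (μ := μ) (isCompact_closedBall _ _).measure_lt_top.ne)
      (hint.mono_set hsub) measurableSet_closedBall fun x hx ↦ ?_
    have : ‖x‖ ≤ r / 2 := mem_closedBall_zero_iff.1 hx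
    exact pow_le_pow_left₀ (ha0.trans hab.le) (by simp only [hb]; gcongr) k
  have hv : 0 < μ.real (closedBall (0 : E) (r / 2)) :=
    ENNReal.toReal_pos (measure_closedBall_pos μ _ (by positivity)).ne'
      (isCompact_closedBall _ _).measure_lt_top.ne
  have hb0 : 0 < b := ha0.trans_lt hab
  have hlim : Filter.Tendsto (fun k : ℕ ↦ (a / b) ^ k * (D * μ.real B)) .atTop (nhds 0) := by
    simpa using (tendsto_pow_atTop_nhds_zero_of_lt_one (div_nonneg ha0 hb0.le)
      ((div_lt_one hb0).2 hab)).mul_const (D * μ.real B)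
  refine hv.not_ge (ge_of_tendsto' hlim fun k ↦ ?_)
  have := (hlower k).trans (hupper k)
  rw [div_pow, div_mul_eq_mul_div, le_div_iff₀ (pow_pos hb0 k)]
  linarith

theorem Continuous.exists_isFixedPt_of_isBounded_range_inner {E : Type*}
    [NormedAddCommGroup E] [InnerProductSpace ℝ E] [FiniteDimensional ℝ E] {f : E → E}
    (hf : Continuous f) (hb : Bornology.IsBounded (Set.range f)) : ∃ x, f x = x := by
  obtain ⟨M, hM0, hM⟩ := hb.exists_pos_norm_le
  replace hM : ∀ x, ‖f x‖ ≤ M := fun x ↦ hM _ ⟨x, rfl⟩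
  let χ : ContDiffBump (0 : E) := ⟨M + 1, M + 2, by positivity, by linarith⟩
  have happrox : ∀ δ : ℝ, 0 < δ → δ ≤ 1 → ∃ x ∈ Metric.closedBall (0 : E) (M + 1), ‖f x - x‖ ≤ δ := by
    intro δ hδ hδ1
    have hcs : HasCompactSupport fun x ↦ χ x • f x := χ.hasCompactSupport.smul_right
    obtain ⟨g, hg, hgf⟩ := (hcs.uniformContinuous_of_continuous
      (χ.continuous.smul hf)).exists_contDiff_dist_le hδ
    obtain ⟨x, hx⟩ := ContDiff.exists_isFixedPt_of_hasCompactSupport (g := fun x ↦ χ x • g x)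
      (χ.contDiff.smul (hg.of_le (by exact_mod_cast le_top))) χ.hasCompactSupport.smul_right
    have hgx : ‖g x‖ ≤ M + 1 := by
      have h1 : ‖χ x • f x‖ ≤ 1 * M := by
        rw [norm_smul, Real.norm_of_nonneg χ.nonneg]
        exact mul_le_mul χ.le_one (hM x) (norm_nonneg _) zero_le_one
      have h2 := norm_le_insert' (g x) (χ x • f x)
      have h3 := hgf x
      rw [dist_eq_norm] at h3
      linarith
    have hxM : x ∈ Metric.closedBall (0 : E) (M + 1) := by
      rw [mem_closedBall_zero_iff, ← hx, norm_smul, Real.norm_of_nonneg χ.nonneg]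
      exact (mul_le_of_le_one_left (norm_nonneg _) χ.le_one).trans hgx
    have hχ : χ x = 1 := χ.one_of_mem_closedBall hxM
    have hgx' := hgf x
    simp only [hχ, one_smul] at hx hgx'
    rw [hx, dist_comm, dist_eq_norm] at hgx'
    exact ⟨x, hxM, hgx'.le⟩
  obtain ⟨x, -, hx⟩ := (isCompact_closedBall (0 : E) (M + 1)).exists_isMinOn
    ⟨0, by simp; positivity⟩ (Continuous.continuousOn (f := fun x ↦ ‖f x - x‖) (by fun_prop))
  refine ⟨x, ?_⟩
  by_contra hne
  have hpos : 0 < ‖f x - x‖ := norm_pos_iff.2 (sub_ne_zero.2 hne)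
  obtain ⟨y, hy, hyδ⟩ := happrox (min (‖f x - x‖ / 2) 1) (by positivity) (min_le_right _ _)
  have h1 : ‖f x - x‖ ≤ ‖f y - y‖ := hx hy
  have h2 := hyδ.trans (min_le_left _ _)
  linarith

/-- **Brouwer's fixed point theorem** for bounded continuous self-maps of a finite-dimensional
real normed space. -/
theorem Continuous.exists_isFixedPt_of_isBounded_range {E : Type*} [NormedAddCommGroup E]
    [NormedSpace ℝ E] [FiniteDimensional ℝ E] {f : E → E} (hf : Continuous f)
    (hb : Bornology.IsBounded (Set.range f)) : ∃ x, f x = x := by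
  let e := toEuclidean (E := E)
  obtain ⟨x, hx⟩ := Continuous.exists_isFixedPt_of_isBounded_range_inner
    (f := fun x ↦ e (f (e.symm x))) (by fun_prop)
    ((e.lipschitz.isBounded_image hb).subset (by rintro _ ⟨x, rfl⟩; exact ⟨_, ⟨_, rfl⟩, rfl⟩))
  exact ⟨e.symm x, by rw [e.eq_symm_apply, hx]⟩

/-- The softmax (logit) distribution with inverse temperature `c`. -/
noncomputable def softmax {A : Type*} [Fintype A] (c : ℝ) (v : A → ℝ) (a : A) : ℝ :=
  Real.exp (c * v a) / ∑ a', Real.exp (c * v a')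

section softmax

variable {A : Type*} [Fintype A] (c : ℝ) (v : A → ℝ)

theorem sum_exp_pos [Nonempty A] : 0 < ∑ a, Real.exp (c * v a) :=
  Finset.sum_pos (fun _ _ ↦ Real.exp_pos _) Finset.univ_nonempty

theorem softmax_pos [Nonempty A] (a : A) : 0 < softmax c v a :=
  div_pos (Real.exp_pos _) (sum_exp_pos c v)

theorem softmax_mem_stdSimplex [Nonempty A] : softmax c v ∈ stdSimplex ℝ A := by
  refine ⟨fun a ↦ (softmax_pos c v a).le, ?_⟩
  simp only [softmax]
  rw [← Finset.sum_div, div_self (sum_exp_pos c v).ne']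

theorem continuous_softmax [Nonempty A] : Continuous (softmax (A := A) c) := by
  refine continuous_pi fun a ↦ Continuous.div (by fun_prop) (by fun_prop) fun v ↦ ?_
  exact (sum_exp_pos c v).ne'

variable {c} in
theorem softmax_mul_sub_le [Nonempty A] (hc : 0 < c) (a b : A) :
    softmax c v a * (v b - v a) ≤ 1 / c := by
  rcases le_total (v b) (v a) with h | h
  · exact (mul_nonpos_of_nonneg_of_nonpos (softmax_pos c v a).le (sub_nonpos.2 h)).trans
      (by positivity)
  have hle : softmax c v a ≤ Real.exp (-(c * (v b - v a))) := by
    rw [softmax, div_le_iff₀ (sum_exp_pos c v)]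
    calc Real.exp (c * v a) = Real.exp (-(c * (v b - v a))) * Real.exp (c * v b) := by
          rw [← Real.exp_add]; ring_nf
      _ ≤ _ := by
          gcongr
          exact Finset.single_le_sum (f := fun a ↦ Real.exp (c * v a))
            (fun _ _ ↦ (Real.exp_pos _).le) (Finset.mem_univ b)
  rw [le_div_iff₀ hc]
  calc softmax c v a * (v b - v a) * c = softmax c v a * (c * (v b - v a)) := by ring
    _ ≤ Real.exp (-(c * (v b - v a))) * Real.exp (c * (v b - v a)) := by
        have := Real.add_one_le_exp (c * (v b - v a))
        have := sub_nonneg.2 h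
        gcongr
        linarith
    _ = 1 := by rw [← Real.exp_add]; simp

end softmax

/-- Strategies: a mixed action for every type. -/
def strategies (S A : Type*) [Fintype A] : Set (S → A → ℝ) :=
  Set.univ.pi fun _ ↦ stdSimplex ℝ A

/-- Perceptions of a player with type space `S` that depend on the opponent's type in `T` and on
the player's action in `A`. -/
def perceptions (S T A : Type*) [Fintype S] : Set (T → A → S → ℝ) :=
  Set.univ.pi fun _ ↦ strategies A S

/-- The Bayesian posterior of an opponent of type `t` over a player's types, given action `a`. -/
noncomputable def posterior {S T A : Type*} [Fintype S] (β : T → S → ℝ) (σ : S → A → ℝ)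
    (t : T) (a : A) (s : S) : ℝ :=
  β t s * σ s a / ∑ s', β t s' * σ s' a

/-- The expected payoff of type `s` from action `a`, given the opponent's strategy `ρ` and
perception `τ`. -/
def payoff {S T A B : Type*} [Fintype T] [Fintype B] (β : S → T → ℝ)
    (u : S → T → A → B → (S → ℝ) → ℝ) (ρ : T → B → ℝ) (τ : T → A → S → ℝ) (s : S) (a : A) : ℝ :=
  ∑ t, ∑ b, β s t * ρ t b * u s t a b (τ t a)

theorem isCompact_strategies (S A : Type*) [Fintype A] : IsCompact (strategies S A) :=
  isCompact_univ_pi fun _ ↦ isCompact_stdSimplex ℝ A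

theorem isCompact_perceptions (S T A : Type*) [Fintype S] : IsCompact (perceptions S T A) :=
  isCompact_univ_pi fun _ ↦ isCompact_strategies A S

theorem sum_mul_pos {S A : Type*} [Fintype S] {p : S → ℝ} (hp : p ∈ stdSimplex ℝ S)
    {σ : S → A → ℝ} (hσ : ∀ s a, 0 < σ s a) (a : A) : 0 < ∑ s, p s * σ s a := by
  obtain ⟨s, -, hs⟩ : ∃ s ∈ Finset.univ, 0 < p s :=
    Finset.exists_lt_of_sum_lt (f := fun _ ↦ (0 : ℝ)) (by simp [hp.2])
  exact Finset.sum_pos' (fun s _ ↦ mul_nonneg (hp.1 s) (hσ s a).le)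
    ⟨s, Finset.mem_univ s, mul_pos hs (hσ s a)⟩

section posterior

variable {S T A : Type*} [Fintype S] {β : T → S → ℝ}

theorem posterior_mem_perceptions (hβ : ∀ t, β t ∈ stdSimplex ℝ S) {σ : S → A → ℝ}
    (hσ : ∀ s a, 0 < σ s a) : posterior β σ ∈ perceptions S T A := by
  refine fun t _ a _ ↦ ⟨fun s ↦ div_nonneg (mul_nonneg ((hβ t).1 s) (hσ s a).le)
    (sum_mul_pos (hβ t) hσ a).le, ?_⟩
  simp only [posterior]
  rw [← Finset.sum_div, div_self (sum_mul_pos (hβ t) hσ a).ne']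

theorem continuous_posterior_comp {X : Type*} [TopologicalSpace X]
    (hβ : ∀ t, β t ∈ stdSimplex ℝ S) {σ : X → S → A → ℝ} (hσ : ∀ x s a, 0 < σ x s a)
    (hcont : Continuous σ) : Continuous fun x ↦ posterior β (σ x) := by
  have h : ∀ s a, Continuous fun x ↦ σ x s a := fun s a ↦ by fun_prop
  exact continuous_pi fun t ↦ continuous_pi fun a ↦ continuous_pi fun s ↦
    (continuous_const.mul (h s a)).div
      (continuous_finsetSum _ fun s _ ↦ continuous_const.mul (h s a))
      fun x ↦ (sum_mul_pos (hβ t) (hσ x) a).ne'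

end posterior

theorem continuousOn_payoff {S T A B : Type*} [Fintype S] [Fintype T] [Fintype B] (β : S → T → ℝ)
    {u : S → T → A → B → (S → ℝ) → ℝ}
    (hu : ∀ s t a b, ContinuousOn (u s t a b) (stdSimplex ℝ S)) :
    ContinuousOn (fun p : (T → B → ℝ) × (T → A → S → ℝ) ↦ payoff β u p.1 p.2)
      (strategies T B ×ˢ perceptions S T A) := by
  refine continuousOn_pi.2 fun s ↦ continuousOn_pi.2 fun a ↦
    continuousOn_finsetSum _ fun t _ ↦ continuousOn_finsetSum _ fun b _ ↦ ?_
  refine ContinuousOn.mul (Continuous.continuousOn (by fun_prop)) ?_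
  exact (hu s t a b).comp (Continuous.continuousOn (by fun_prop))
    fun p hp ↦ hp.2 t trivial a trivial

/-- Logit equilibria: full-support strategies at which no type gains much by shifting
probability between actions. -/
theorem exists_logit_equilibrium {T1 T2 A1 A2 : Type*} [Fintype T1] [Fintype T2] [Fintype A1]
    [Fintype A2] [Nonempty A1] [Nonempty A2]
    {β1 : T1 → T2 → ℝ} (hβ1 : ∀ t1, β1 t1 ∈ stdSimplex ℝ T2)
    {β2 : T2 → T1 → ℝ} (hβ2 : ∀ t2, β2 t2 ∈ stdSimplex ℝ T1)
    {u1 : T1 → T2 → A1 → A2 → (T1 → ℝ) → ℝ} {u2 : T2 → T1 → A2 → A1 → (T2 → ℝ) → ℝ}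
    (hu1 : ∀ t1 t2 a1 a2, ContinuousOn (u1 t1 t2 a1 a2) (stdSimplex ℝ T1))
    (hu2 : ∀ t2 t1 a2 a1, ContinuousOn (u2 t2 t1 a2 a1) (stdSimplex ℝ T2)) {c : ℝ} (hc : 0 < c) :
    ∃ σ1 ∈ strategies T1 A1, ∃ σ2 ∈ strategies T2 A2,
      (∀ s a, 0 < σ1 s a) ∧ (∀ s a, 0 < σ2 s a) ∧
      (∀ s a b, σ1 s a * (payoff β1 u1 σ2 (posterior β2 σ1) s b -
        payoff β1 u1 σ2 (posterior β2 σ1) s a) ≤ 1 / c) ∧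
      ∀ s a b, σ2 s a * (payoff β2 u2 σ1 (posterior β1 σ2) s b -
        payoff β2 u2 σ1 (posterior β1 σ2) s a) ≤ 1 / c := by
  let E := (T1 → A1 → ℝ) × (T2 → A2 → ℝ)
  let σ1 : E → T1 → A1 → ℝ := fun z t ↦ softmax c (z.1 t)
  let σ2 : E → T2 → A2 → ℝ := fun z t ↦ softmax c (z.2 t)
  have hc1 : Continuous σ1 := continuous_pi fun t ↦
    (continuous_softmax c).comp ((continuous_apply t).comp continuous_fst)
  have hc2 : Continuous σ2 := continuous_pi fun t ↦
    (continuous_softmax c).comp ((continuous_apply t).comp continuous_snd)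
  have hp1 : ∀ z s a, 0 < σ1 z s a := fun z s a ↦ softmax_pos _ _ _
  have hp2 : ∀ z s a, 0 < σ2 z s a := fun z s a ↦ softmax_pos _ _ _
  have hm1 : ∀ z, σ1 z ∈ strategies T1 A1 := fun z t _ ↦ softmax_mem_stdSimplex _ _
  have hm2 : ∀ z, σ2 z ∈ strategies T2 A2 := fun z t _ ↦ softmax_mem_stdSimplex _ _
  let g1 : E → (T2 → A2 → ℝ) × (T2 → A1 → T1 → ℝ) := fun z ↦ (σ2 z, posterior β2 (σ1 z))
  let g2 : E → (T1 → A1 → ℝ) × (T1 → A2 → T2 → ℝ) := fun z ↦ (σ1 z, posterior β1 (σ2 z))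
  have hg1 : Continuous g1 := hc2.prodMk (continuous_posterior_comp hβ2 hp1 hc1)
  have hg2 : Continuous g2 := hc1.prodMk (continuous_posterior_comp hβ1 hp2 hc2)
  have hgm1 : ∀ z, g1 z ∈ strategies T2 A2 ×ˢ perceptions T1 T2 A1 := fun z ↦
    ⟨hm2 z, posterior_mem_perceptions hβ2 (hp1 z)⟩
  have hgm2 : ∀ z, g2 z ∈ strategies T1 A1 ×ˢ perceptions T2 T1 A2 := fun z ↦
    ⟨hm1 z, posterior_mem_perceptions hβ1 (hp2 z)⟩
  have hV1 := continuousOn_payoff β1 hu1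
  have hV2 := continuousOn_payoff β2 hu2
  have hcomp1 := ((isCompact_strategies T2 A2).prod
    (isCompact_perceptions T1 T2 A1)).image_of_continuousOn hV1
  have hcomp2 := ((isCompact_strategies T1 A1).prod
    (isCompact_perceptions T2 T1 A2)).image_of_continuousOn hV2
  obtain ⟨z, hz⟩ := Continuous.exists_isFixedPt_of_isBounded_range
    (f := fun z : E ↦ (payoff β1 u1 (g1 z).1 (g1 z).2, payoff β2 u2 (g2 z).1 (g2 z).2))
    ((hV1.comp_continuous hg1 hgm1).prodMk (hV2.comp_continuous hg2 hgm2))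
    ((hcomp1.prod hcomp2).isBounded.subset (by
      rintro _ ⟨z, rfl⟩
      exact ⟨⟨_, hgm1 z, rfl⟩, ⟨_, hgm2 z, rfl⟩⟩))
  have hz1 : payoff β1 u1 (σ2 z) (posterior β2 (σ1 z)) = z.1 := congrArg Prod.fst hz
  have hz2 : payoff β2 u2 (σ1 z) (posterior β1 (σ2 z)) = z.2 := congrArg Prod.snd hz
  refine ⟨σ1 z, hm1 z, σ2 z, hm2 z, hp1 z, hp2 z, fun s a b ↦ ?_, fun s a b ↦ ?_⟩
  · rw [hz1]; exact softmax_mul_sub_le _ hc a b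
  · rw [hz2]; exact softmax_mul_sub_le _ hc a b

section limit

open Filter Topology

variable {S T A B : Type*} [Fintype S]

theorem consistent_of_tendsto {β : T → S → ℝ} {σ : ℕ → S → A → ℝ} {σ' : S → A → ℝ}
    {τ' : T → A → S → ℝ} (hσ : Tendsto σ atTop (𝓝 σ'))
    (hτ : Tendsto (fun n ↦ posterior β (σ n)) atTop (𝓝 τ')) (t : T) (a : A)
    (h : 0 < ∑ s, β t s * σ' s a) (s : S) :
    τ' t a s = posterior β σ' t a s := by
  have hlim : ∀ s, Tendsto (fun n ↦ β t s * σ n s a) atTop (𝓝 (β t s * σ' s a)) := fun s ↦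
    ((hσ.apply_nhds s).apply_nhds a).const_mul _
  exact tendsto_nhds_unique (((hτ.apply_nhds t).apply_nhds a).apply_nhds s)
    ((hlim s).div (tendsto_finsetSum _ fun s _ ↦ hlim s) h.ne')

theorem sum_mul_le_sum_mul_of_mul_sub_nonpos [Fintype A] {p q v : A → ℝ}
    (hp : p ∈ stdSimplex ℝ A) (hq : q ∈ stdSimplex ℝ A)
    (h : ∀ a b, p a * (v b - v a) ≤ 0) : ∑ a, q a * v a ≤ ∑ a, p a * v a := by
  have hb : ∀ b, v b ≤ ∑ a, p a * v a := fun b ↦ by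
    have := Finset.sum_nonpos fun a (_ : a ∈ Finset.univ) ↦ h a b
    simp only [mul_sub, Finset.sum_sub_distrib, ← Finset.sum_mul, hp.2, one_mul] at this
    linarith
  calc ∑ b, q b * v b ≤ ∑ b, q b * ∑ a, p a * v a :=
        Finset.sum_le_sum fun b _ ↦ mul_le_mul_of_nonneg_left (hb b) (hq.1 b)
    _ = ∑ a, p a * v a := by rw [← Finset.sum_mul, hq.2, one_mul]

theorem bestReply_of_tendsto [Fintype T] [Fintype A] [Fintype B] {β : S → T → ℝ}
    {u : S → T → A → B → (S → ℝ) → ℝ}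
    (hu : ∀ s t a b, ContinuousOn (u s t a b) (stdSimplex ℝ S))
    {σ : ℕ → S → A → ℝ} {ρ : ℕ → T → B → ℝ} {τ : ℕ → T → A → S → ℝ}
    {σ' : S → A → ℝ} {ρ' : T → B → ℝ} {τ' : T → A → S → ℝ} {ε : ℕ → ℝ}
    (hρm : ∀ n, ρ n ∈ strategies T B) (hτm : ∀ n, τ n ∈ perceptions S T A)
    (hσm' : σ' ∈ strategies S A) (hρm' : ρ' ∈ strategies T B) (hτm' : τ' ∈ perceptions S T A)
    (hσ : Tendsto σ atTop (𝓝 σ')) (hρ : Tendsto ρ atTop (𝓝 ρ')) (hτ : Tendsto τ atTop (𝓝 τ'))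
    (hε : Tendsto ε atTop (𝓝 0))
    (h : ∀ n s a b, σ n s a * (payoff β u (ρ n) (τ n) s b - payoff β u (ρ n) (τ n) s a) ≤ ε n)
    (s : S) (q : A → ℝ) (hq : q ∈ stdSimplex ℝ A) :
    ∑ a, ∑ t, ∑ b, q a * β s t * ρ' t b * u s t a b (τ' t a) ≤
      ∑ a, ∑ t, ∑ b, σ' s a * β s t * ρ' t b * u s t a b (τ' t a) := by
  have hpair : Tendsto (fun n ↦ (ρ n, τ n)) atTop
      (𝓝[strategies T B ×ˢ perceptions S T A] (ρ', τ')) :=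
    tendsto_nhdsWithin_iff.2 ⟨hρ.prodMk_nhds hτ, .of_forall fun n ↦ ⟨hρm n, hτm n⟩⟩
  have hcont : ContinuousWithinAt (fun p : (T → B → ℝ) × (T → A → S → ℝ) ↦ payoff β u p.1 p.2)
      (strategies T B ×ˢ perceptions S T A) (ρ', τ') :=
    continuousOn_payoff β hu _ ⟨hρm', hτm'⟩
  have hV : Tendsto (fun n ↦ payoff β u (ρ n) (τ n)) atTop (𝓝 (payoff β u ρ' τ')) := by
    have hcomp := Tendsto.comp hcont hpair
    simpa only [Function.comp_def] using hcomp
  have hVa : ∀ a, Tendsto (fun n ↦ payoff β u (ρ n) (τ n) s a) atTop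
      (𝓝 (payoff β u ρ' τ' s a)) := fun a ↦ (hV.apply_nhds s).apply_nhds a
  have hσa : ∀ a, Tendsto (fun n ↦ σ n s a) atTop (𝓝 (σ' s a)) := fun a ↦
    (hσ.apply_nhds s).apply_nhds a
  have hlim : ∀ a b, σ' s a * (payoff β u ρ' τ' s b - payoff β u ρ' τ' s a) ≤ 0 := fun a b ↦
    le_of_tendsto_of_tendsto' ((hσa a).mul ((hVa b).sub (hVa a))) hε fun n ↦ h n s a b
  have hsum : ∀ r : A → ℝ, ∑ a, ∑ t, ∑ b, r a * β s t * ρ' t b * u s t a b (τ' t a) =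
      ∑ a, r a * payoff β u ρ' τ' s a := fun r ↦ by
    simp only [payoff, Finset.mul_sum, mul_assoc]
  rw [hsum, hsum]
  exact sum_mul_le_sum_mul_of_mul_sub_nonpos (hσm' s trivial) hq hlim

end limit

/-- Proposition B.1: existence of a perception equilibrium in any
finite two-player perception game whose utilities are continuous in the
perception argument. -/
theorem exists_two_player_perception_equilibrium
    {T1 T2 A1 A2 : Type*} [Fintype T1] [Fintype T2] [Fintype A1] [Fintype A2]
    [Nonempty T1] [Nonempty T2] [Nonempty A1] [Nonempty A2]
    (β1 : T1 → T2 → ℝ) (hβ1 : ∀ t1, β1 t1 ∈ stdSimplex ℝ T2)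
    (β2 : T2 → T1 → ℝ) (hβ2 : ∀ t2, β2 t2 ∈ stdSimplex ℝ T1)
    (u1 : T1 → T2 → A1 → A2 → (T1 → ℝ) → ℝ)
    (u2 : T2 → T1 → A2 → A1 → (T2 → ℝ) → ℝ)
    (hu1 : ∀ t1 t2 a1 a2, ContinuousOn (u1 t1 t2 a1 a2) (stdSimplex ℝ T1))
    (hu2 : ∀ t2 t1 a2 a1, ContinuousOn (u2 t2 t1 a2 a1) (stdSimplex ℝ T2)) :
    ∃ (σ1 : T1 → A1 → ℝ) (σ2 : T2 → A2 → ℝ)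
      (τ1 : T1 → T2 → A1 → T1 → ℝ) (τ2 : T2 → T1 → A2 → T2 → ℝ),
      (∀ t1, σ1 t1 ∈ stdSimplex ℝ A1) ∧ (∀ t2, σ2 t2 ∈ stdSimplex ℝ A2) ∧
      (∀ t1 t2 a1, τ1 t1 t2 a1 ∈ stdSimplex ℝ T1) ∧
      (∀ t2 t1 a2, τ2 t2 t1 a2 ∈ stdSimplex ℝ T2) ∧
      -- player 1 is Bayesian-consistent
      (∀ (t1 : T1) (t2 : T2) (a1 : A1),
        0 < ∑ s1, β2 t2 s1 * σ1 s1 a1 →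
        ∀ tb1, τ1 t1 t2 a1 tb1 =
          β2 t2 tb1 * σ1 tb1 a1 / ∑ s1, β2 t2 s1 * σ1 s1 a1) ∧
      -- player 2 is Bayesian-consistent
      (∀ (t2 : T2) (t1 : T1) (a2 : A2),
        0 < ∑ s2, β1 t1 s2 * σ2 s2 a2 →
        ∀ tb2, τ2 t2 t1 a2 tb2 =
          β1 t1 tb2 * σ2 tb2 a2 / ∑ s2, β1 t1 s2 * σ2 s2 a2) ∧
      -- every type of player 1 best-replies
      (∀ t1, ∀ s ∈ stdSimplex ℝ A1,
        (∑ a, ∑ t2, ∑ b, s a * β1 t1 t2 * σ2 t2 b * u1 t1 t2 a b (τ1 t1 t2 a)) ≤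
        ∑ a, ∑ t2, ∑ b, σ1 t1 a * β1 t1 t2 * σ2 t2 b * u1 t1 t2 a b (τ1 t1 t2 a)) ∧
      -- every type of player 2 best-replies
      (∀ t2, ∀ s ∈ stdSimplex ℝ A2,
        (∑ a, ∑ t1, ∑ b, s a * β2 t2 t1 * σ1 t1 b * u2 t2 t1 a b (τ2 t2 t1 a)) ≤
        ∑ a, ∑ t1, ∑ b, σ2 t2 a * β2 t2 t1 * σ1 t1 b * u2 t2 t1 a b (τ2 t2 t1 a)) := by
  choose σ1 hm1 σ2 hm2 hp1 hp2 h1 h2 using fun n : ℕ ↦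
    exists_logit_equilibrium hβ1 hβ2 hu1 hu2 (c := n + 1) (by positivity)
  have hτ1 := fun n ↦ posterior_mem_perceptions hβ2 (hp1 n)
  have hτ2 := fun n ↦ posterior_mem_perceptions hβ1 (hp2 n)
  obtain ⟨⟨⟨σ1', σ2'⟩, ⟨τ1', τ2'⟩⟩, ⟨⟨hσ1', hσ2'⟩, ⟨hτ1', hτ2'⟩⟩, φ, hφ, hlim⟩ :=
    (((isCompact_strategies T1 A1).prod (isCompact_strategies T2 A2)).prod
      ((isCompact_perceptions T1 T2 A1).prod (isCompact_perceptions T2 T1 A2))).tendsto_subseq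
      (x := fun n ↦ ((σ1 n, σ2 n), (posterior β2 (σ1 n), posterior β1 (σ2 n))))
      fun n ↦ ⟨⟨hm1 n, hm2 n⟩, ⟨hτ1 n, hτ2 n⟩⟩
  have hσ1 := hlim.fst_nhds.fst_nhds
  have hσ2 := hlim.fst_nhds.snd_nhds
  have hlτ1 := hlim.snd_nhds.fst_nhds
  have hlτ2 := hlim.snd_nhds.snd_nhds
  have hε := tendsto_one_div_add_atTop_nhds_zero_nat (𝕜 := ℝ) |>.comp hφ.tendsto_atTop
  exact ⟨σ1', σ2', fun _ t2 a ↦ τ1' t2 a, fun _ t1 a ↦ τ2' t1 a,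
    fun t ↦ hσ1' t trivial, fun t ↦ hσ2' t trivial,
    fun _ t a ↦ hτ1' t trivial a trivial, fun _ t a ↦ hτ2' t trivial a trivial,
    fun _ t a h s ↦ consistent_of_tendsto hσ1 hlτ1 t a h s,
    fun _ t a h s ↦ consistent_of_tendsto hσ2 hlτ2 t a h s,
    bestReply_of_tendsto hu1 (fun n ↦ hm2 (φ n)) (fun n ↦ hτ1 (φ n)) hσ1' hσ2' hτ1'
      hσ1 hσ2 hlτ1 hε fun n ↦ h1 (φ n),
    bestReply_of_tendsto hu2 (fun n ↦ hm1 (φ n)) (fun n ↦ hτ2 (φ n)) hσ2' hσ1' hτ2'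
      hσ2 hσ1 hlτ2 hε fun n ↦ h2 (φ n)⟩
end
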